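/- Let V be a level zero irreducible integrable module for the twisted full toroidal Lie algebra τ̃ having finite-dimensional weight spaces with respect to h̃. Then 𝒵(m) acts trivially on V. -/

import Mathlib

open scoped BigOperators TensorProduct

noncomputable section

/-- Stage 1: a finite-dimensional simple complex Lie algebra `g` together with `n` commuting
automorphisms `σ i` of finite orders `m i`, fixed primitive roots of unity `ξ i`, and the
invariant nondegenerate symmetric bilinear form `bil`. -/
structure PreT where
  n : ℕ
  npos : 0 < n
  m : Fin n → ℕ
  mpos : ∀ i, 0 < m i
  g : Type
  [gLR : LieRing g]
  [gLA : LieAlgebra ℂ g]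
  gfin : FiniteDimensional ℂ g
  gsimple : LieAlgebra.IsSimple ℂ g
  σ : Fin n → (g ≃ₗ⁅ℂ⁆ g)
  σcomm : ∀ i j x, σ i (σ j x) = σ j (σ i x)
  σord : ∀ i x, (fun y => σ i y)^[m i] x = x
  ξ : Fin n → ℂ
  ξprim : ∀ i, IsPrimitiveRoot (ξ i) (m i)
  bil : g →ₗ[ℂ] g →ₗ[ℂ] ℂ
  bil_symm : ∀ x y, bil x y = bil y x
  bil_invariant : ∀ x y z, bil ⁅x, y⁆ z = bil x ⁅y, z⁆
  bil_nondeg : ∀ x, (∀ y, bil x y = 0) → x = 0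
  bil_aut : ∀ i x y, bil (σ i x) (σ i y) = bil x y

attribute [instance] PreT.gLR PreT.gLA

namespace PreT

variable (P : PreT)

/-- membership in the lattice `Γ = m₁ℤ ⊕ … ⊕ mₙℤ`. -/
def inΓ (r : Fin P.n → ℤ) : Prop := ∀ i, (P.m i : ℤ) ∣ r i

/-- the common eigenspace `𝔤_{k̄} = {x | σᵢ x = ξᵢ^{kᵢ} x}`. -/
def gr (k : Fin P.n → ℤ) : Submodule ℂ P.g :=
  ⨅ i, LinearMap.ker
    ((P.σ i).toLinearEquiv.toLinearMap - P.ξ i ^ (k i) • (1 : Module.End ℂ P.g))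

/-- Ĝ-characters: group homomorphisms `ℤⁿ/Γ → ℂˣ` presented as `Γ`-periodic functions. -/
def IsChar (χ : (Fin P.n → ℤ) → ℂ) : Prop :=
  (∀ k l, χ (k + l) = χ k * χ l) ∧ (∀ r, P.inΓ r → χ r = 1)

end PreT

/-- Stage 2: a Cartan subalgebra `h0 = 𝔥_{0̄}` of `𝔤_{0̄}` (abelian and self-normalizing
in `𝔤_{0̄}`). -/
structure Cartan (P : PreT) where
  h0 : Submodule ℂ P.g
  h0_le : h0 ≤ P.gr 0
  h0_ne : h0 ≠ ⊥
  h0_abelian : ∀ x ∈ h0, ∀ y ∈ h0, ⁅x, y⁆ = 0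
  h0_selfnorm : ∀ x ∈ P.gr 0, (∀ h ∈ h0, ⁅h, x⁆ ∈ h0) → x ∈ h0

namespace Cartan

variable {P : PreT} (C : Cartan P)

/-- the full weight space `{x ∈ 𝔤 | [h,x] = α(h)x ∀ h ∈ 𝔥_{0̄}}` of `𝔤` for `α ∈ 𝔥_{0̄}*`. -/
def wtfull (α : Module.Dual ℂ ↥C.h0) : Submodule ℂ P.g :=
  ⨅ h : ↥C.h0, LinearMap.ker
    (LieAlgebra.ad ℂ P.g (h : P.g) - α h • (1 : Module.End ℂ P.g))

/-- the root space `𝔤_{k̄}(α)`. -/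
def wtg (k : Fin P.n → ℤ) (α : Module.Dual ℂ ↥C.h0) : Submodule ℂ P.g :=
  P.gr k ⊓ C.wtfull α

/-- the set `Δ^× = Δ_{0,en}^×` of nonzero roots. -/
def Δen : Set (Module.Dual ℂ ↥C.h0) :=
  {α | α ≠ 0 ∧ ∃ k, C.wtg k α ≠ ⊥}

/-- weights for `h̃ = 𝔥_{0̄} ⊕ ⊕ᵢℂKᵢ ⊕ ⊕ᵢℂdᵢ`: a functional on `𝔥_{0̄}` together with the
values on `K₁,…,Kₙ` and on `d₁,…,dₙ`. -/
abbrev Wt : Type := Module.Dual ℂ ↥C.h0 × (Fin P.n → ℂ) × (Fin P.n → ℂ)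

/-- a real root `γ = α + δ_k` of `τ̃`, regarded as an element of `h̃*`. -/
def rootFn (α : Module.Dual ℂ ↥C.h0) (k : Fin P.n → ℤ) : C.Wt :=
  (α, 0, fun i => (k i : ℂ))

end Cartan

/-- Stage 3: the Lie-torus axioms together with a choice of a positive system and of coroots for
the (extended) root system `Δ_{0,en}`. -/
structure Torus (P : PreT) (C : Cartan P) where
  /-- `𝔤_{0̄}` is a (finite-dimensional) simple Lie algebra: no proper nonzero ideals … -/
  g0_ideals : ∀ U : Submodule ℂ P.g, U ≤ P.gr 0 →
    (∀ x ∈ P.gr 0, ∀ u ∈ U, ⁅x, u⁆ ∈ U) → U = ⊥ ∨ U = P.gr 0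
  /-- … and nonabelian. -/
  g0_nonabelian : ∃ x ∈ P.gr 0, ∃ y ∈ P.gr 0, ⁅x, y⁆ ≠ 0
  /-- condition (M): for `k̄ ≠ 0̄` with `𝔤_{k̄} ≠ 0`, `𝔤_{k̄} ≅ U ⊕ W` with `U` a trivial
  `𝔤_{0̄}`-module and `W` zero or irreducible of dimension `> 1` with weights in `Δ_{0,en}`. -/
  cond_M : ∀ k : Fin P.n → ℤ, ¬ P.inΓ k → P.gr k ≠ ⊥ →
    ∃ U W : Submodule ℂ P.g, U ≤ P.gr k ∧ W ≤ P.gr k ∧ U ⊓ W = ⊥ ∧ U ⊔ W = P.gr k ∧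
      (∀ x ∈ P.gr 0, ∀ u ∈ U, ⁅x, u⁆ = 0) ∧
      (W = ⊥ ∨
        ((∀ U' : Submodule ℂ P.g, U' ≤ W →
            (∀ x ∈ P.gr 0, ∀ u ∈ U', ⁅x, u⁆ ∈ U') → U' = ⊥ ∨ U' = W) ∧
          1 < Module.finrank ℂ ↥W ∧
          W ≤ ⨆ α ∈ insert (0 : Module.Dual ℂ ↥C.h0) C.Δen, C.wtfull α))
  /-- condition (iii): the group generated by `σ₁,…,σₙ` has order `m₁ ⋯ mₙ`. -/
  ord_faithful : ∀ k : Fin P.n → ℤ,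
    (∀ l, P.gr l ≠ ⊥ → (∏ i, P.ξ i ^ (k i * l i)) = 1) → P.inΓ k
  /-- a positive system for `Δ_{0,en}`. -/
  pos : Set (Module.Dual ℂ ↥C.h0)
  pos_sub : pos ⊆ C.Δen
  pos_total : ∀ α ∈ C.Δen, α ∈ pos ∨ -α ∈ pos
  pos_disj : ∀ α ∈ pos, -α ∉ pos
  pos_add : ∀ α ∈ pos, ∀ β ∈ pos, α + β ∈ C.Δen → α + β ∈ pos
  /-- coroots `α∨ ∈ 𝔥_{0̄}`. -/
  coroot : Module.Dual ℂ ↥C.h0 → ↥C.h0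
  coroot_two : ∀ α ∈ C.Δen, α (coroot α) = 2
  coroot_neg : ∀ α ∈ C.Δen, coroot (-α) = - coroot α
  /-- `cnorm α = 2/(α|α)`, characterized via the bilinear form. -/
  cnorm : Module.Dual ℂ ↥C.h0 → ℂ
  cnorm_spec : ∀ α ∈ C.Δen, ∀ h : ↥C.h0,
    P.bil ((coroot α : P.g)) ((h : P.g)) = cnorm α * α h

namespace Torus

variable {P : PreT} {C : Cartan P} (T : Torus P C)

/-- evaluation `λ(γ∨)` of a weight `λ` at the coroot `γ∨ = α∨ + (2/(α|α)) Σᵢ kᵢKᵢ` of the real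
root `γ = α + δ_k`. -/
def corootEval (α : Module.Dual ℂ ↥C.h0) (k : Fin P.n → ℤ) (w : C.Wt) : ℂ :=
  w.1 (T.coroot α) + T.cnorm α * ∑ i, (k i : ℂ) * w.2.1 i

/-- the reflection `r_γ(λ) = λ - λ(γ∨)γ` on `h̃*`. -/
def reflFn (α : Module.Dual ℂ ↥C.h0) (k : Fin P.n → ℤ) : Function.End C.Wt :=
  fun w => w - T.corootEval α k w • C.rootFn α k

/-- the Weyl group `W` of `τ̃`, generated by the reflections in the real roots
(realized inside the monoid of self-maps of `h̃*`; as the generators are involutions this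
coincides with the generated group). -/
def weyl : Submonoid (Function.End C.Wt) :=
  Submonoid.closure {f | ∃ α ∈ C.Δen, ∃ k, f = T.reflFn α k}

end Torus

/-- Stage 4: the twisted full toroidal Lie algebra
`τ̃ = LT ⊕ 𝒵(m) ⊕ 𝒟(m)`.  The elements `E k x` (for `x ∈ 𝔤_{k̄}`), `K r i` and `Dop r i`
(for `r ∈ Γ`) realize `x ⊗ t^k`, `t^r Kᵢ` and `t^r dᵢ`, subject to the standard toroidal
bracket relations, with 2-cocycle `φ = c1 • φ₁ + c2 • φ₂`. -/
structure Toroidal (P : PreT) (C : Cartan P) (T : Torus P C) where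
  τ : Type
  [τLR : LieRing τ]
  [τLA : LieAlgebra ℂ τ]
  E : (Fin P.n → ℤ) → P.g →ₗ[ℂ] τ
  K : (Fin P.n → ℤ) → Fin P.n → τ
  Dop : (Fin P.n → ℤ) → Fin P.n → τ
  c1 : ℂ
  c2 : ℂ
  K_not : ∀ r i, ¬ P.inΓ r → K r i = 0
  Dop_not : ∀ r i, ¬ P.inΓ r → Dop r i = 0
  /-- the relation `Σᵢ rᵢ t^r Kᵢ = 0` coming from `dA(m)` in `𝒵(m) = Ω_{A(m)}/dA(m)`. -/
  K_dA : ∀ r, P.inΓ r → ∑ i, (r i : ℂ) • K r i = 0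
  br_EE : ∀ k l x y, x ∈ P.gr k → y ∈ P.gr l →
    ⁅E k x, E l y⁆ = E (k + l) ⁅x, y⁆ + P.bil x y • ∑ i, (k i : ℂ) • K (k + l) i
  br_EK : ∀ k x, x ∈ P.gr k → ∀ r i, ⁅E k x, K r i⁆ = 0
  br_KK : ∀ r s i j, ⁅K r i, K s j⁆ = 0
  br_DK : ∀ r s, P.inΓ r → P.inΓ s → ∀ i j,
    ⁅Dop r i, K s j⁆ = (s i : ℂ) • K (r + s) j +
      (if i = j then (1 : ℂ) else 0) • ∑ p, (r p : ℂ) • K (r + s) p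
  br_DD : ∀ r s, P.inΓ r → P.inΓ s → ∀ i j,
    ⁅Dop r i, Dop s j⁆ = (s i : ℂ) • Dop (r + s) j - (r j : ℂ) • Dop (r + s) i +
      (c1 * (-(s i : ℂ) * (r j : ℂ)) + c2 * ((r i : ℂ) * (s j : ℂ))) •
        ∑ p, (r p : ℂ) • K (r + s) p
  br_DE : ∀ r, P.inΓ r → ∀ i k x, x ∈ P.gr k → ⁅Dop r i, E k x⁆ = (k i : ℂ) • E (r + k) x
  span_top : Submodule.span ℂ
    ({t | ∃ k x, x ∈ P.gr k ∧ t = E k x} ∪ {t | ∃ r i, P.inΓ r ∧ t = K r i} ∪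
      {t | ∃ r i, P.inΓ r ∧ t = Dop r i}) = ⊤
  E_inj : ∀ k x, x ∈ P.gr k → E k x = 0 → x = 0

attribute [instance] Toroidal.τLR Toroidal.τLA

namespace Toroidal

variable {P : PreT} {C : Cartan P} {T : Torus P C} (X : Toroidal P C T)

/-- the generators `𝔤_{k̄}(α) ⊗ ℂt^k`, `α` positive, of `τ̃₊`. -/
def tauP : Set X.τ :=
  {t | ∃ α ∈ T.pos, ∃ k x, x ∈ C.wtg k α ∧ t = X.E k x}

/-- the generators `𝔤_{k̄}(α) ⊗ ℂt^k`, `α` negative, of `τ̃₋`. -/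
def tauM : Set X.τ :=
  {t | ∃ α, -α ∈ T.pos ∧ ∃ k x, x ∈ C.wtg k α ∧ t = X.E k x}

/-- the generators `𝔤_{k̄}(0) ⊗ ℂt^k`, `t^rKᵢ`, `t^rdᵢ` of `τ̃₀`. -/
def tauZ : Set X.τ :=
  {t | (∃ k x, x ∈ C.wtg k 0 ∧ t = X.E k x) ∨
    (∃ r i, P.inΓ r ∧ (t = X.K r i ∨ t = X.Dop r i))}

/-- the generators of `τ̂ = LT ⊕ 𝒟(m)`. -/
def tauHat : Set X.τ :=
  {t | (∃ k x, x ∈ P.gr k ∧ t = X.E k x) ∨ (∃ r i, P.inΓ r ∧ t = X.Dop r i)}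

/-- the element `I(u,r) = D(u,r) - D(u,0) = Σᵢ uᵢ t^r dᵢ - Σᵢ uᵢ dᵢ`. -/
def Iop (u : Fin P.n → ℂ) (r : Fin P.n → ℤ) : X.τ :=
  ∑ i, u i • X.Dop r i - ∑ i, u i • X.Dop 0 i

/-- generators of `L̃ = I ⋉ L(g̊,σ)`, where `g̊` is the centralizer of `𝔥_{0̄}` in `𝔤`. -/
def Ltil : Set X.τ :=
  {t | (∃ u r, P.inΓ r ∧ t = X.Iop u r) ∨
    (∃ k x, x ∈ P.gr k ∧ x ∈ C.wtfull 0 ∧ t = X.E k x)}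

/-- generators of `I ⋉ (𝔥_{0̄} ⊗ A(m))`. -/
def IhGen : Set X.τ :=
  {t | (∃ u r, P.inΓ r ∧ t = X.Iop u r) ∨
    (∃ r h, P.inΓ r ∧ h ∈ C.h0 ∧ h ∈ P.gr r ∧ h ∈ C.wtfull 0 ∧ t = X.E r h)}

end Toroidal

/-- a representation of `τ̃` on a complex vector space. -/
structure TRep {P : PreT} {C : Cartan P} {T : Torus P C} (X : Toroidal P C T) where
  V : Type
  [Vadd : AddCommGroup V]
  [Vmod : Module ℂ V]
  ρ : X.τ →ₗ[ℂ] Module.End ℂ V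
  ρ_lie : ∀ a b : X.τ, ρ ⁅a, b⁆ = ρ a * ρ b - ρ b * ρ a

attribute [instance] TRep.Vadd TRep.Vmod

namespace TRep

variable {P : PreT} {C : Cartan P} {T : Torus P C} {X : Toroidal P C T} (M : TRep X)

/-- the weight space `V_w` with respect to `h̃`. -/
def wtSp (w : C.Wt) : Submodule ℂ M.V :=
  (⨅ h : ↥C.h0, LinearMap.ker (M.ρ (X.E 0 (h : P.g)) - w.1 h • (1 : Module.End ℂ M.V))) ⊓
  (⨅ i, LinearMap.ker (M.ρ (X.K 0 i) - w.2.1 i • (1 : Module.End ℂ M.V))) ⊓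
  (⨅ i, LinearMap.ker (M.ρ (X.Dop 0 i) - w.2.2 i • (1 : Module.End ℂ M.V)))

/-- the set `P(V)` of weights of `V`. -/
def wts : Set C.Wt := {w | M.wtSp w ≠ ⊥}

/-- `V` is a weight module: `V = ⊕_{λ ∈ h̃*} V_λ`. -/
def IsWeight : Prop := (⨆ w : C.Wt, M.wtSp w) = ⊤

/-- `V` has finite-dimensional weight spaces. -/
def FinWt : Prop := ∀ w : C.Wt, FiniteDimensional ℂ ↥(M.wtSp w)

/-- integrability: `V` is a weight module on which all the root vectors
`x ∈ 𝔤_{k̄}(α) ⊗ ℂt^k`, `α ≠ 0`, act locally nilpotently. -/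
def Integrable : Prop :=
  M.IsWeight ∧ ∀ (k : Fin P.n → ℤ) (α : Module.Dual ℂ ↥C.h0), α ≠ 0 →
    ∀ x ∈ C.wtg k α, ∀ v : M.V, ∃ N : ℕ, (M.ρ (X.E k x) ^ N) v = 0

/-- level zero: the central elements `K₁, …, Kₙ` act trivially. -/
def LevelZero : Prop := ∀ i, M.ρ (X.K 0 i) = 0

/-- irreducibility of `V` over `τ̃`. -/
def Irr : Prop :=
  Nontrivial M.V ∧
    ∀ U : Submodule ℂ M.V, (∀ t : X.τ, ∀ v ∈ U, M.ρ t v ∈ U) → U = ⊥ ∨ U = ⊤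

/-- the Lie torus `LT` acts non-trivially on `V`. -/
def LTnontrivial : Prop := ∃ k x, x ∈ P.gr k ∧ M.ρ (X.E k x) ≠ 0

/-- the highest weight space `V₊ = {v ∈ V | τ̃₊ ⬝ v = 0}`. -/
def Vplus : Submodule ℂ M.V := ⨅ t ∈ X.tauP, LinearMap.ker (M.ρ t)

/-- `U(τ̃₀)v`: the smallest subspace of `V` containing `v` and invariant under `τ̃₀`. -/
def u0span (v : M.V) : Submodule ℂ M.V :=
  sInf {U | v ∈ U ∧ ∀ t ∈ X.tauZ, ∀ u ∈ U, M.ρ t u ∈ U}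

/-- `V` is a level zero highest weight module for `τ̃` (Definition 3.3). -/
def IsHW : Prop :=
  ∃ v : M.V, v ≠ 0 ∧ (∃ w : C.Wt, v ∈ M.wtSp w) ∧
    (∀ U : Submodule ℂ M.V, (∀ t : X.τ, ∀ u ∈ U, M.ρ t u ∈ U) → v ∈ U → U = ⊤) ∧
    (∀ t ∈ X.tauP, M.ρ t v = 0) ∧
    (∀ U : Submodule ℂ M.V, U ≤ M.u0span v →
      (∀ t ∈ X.tauZ, ∀ u ∈ U, M.ρ t u ∈ U) → U = ⊥ ∨ U = M.u0span v) ∧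
    (∀ i, M.ρ (X.K 0 i) = 0)

/-- simultaneous eigenspace for the degree derivations `d₁,…,dₙ`. -/
def dEig (b : Fin P.n → ℂ) : Submodule ℂ M.V :=
  ⨅ i, LinearMap.ker (M.ρ (X.Dop 0 i) - b i • (1 : Module.End ℂ M.V))

/-- the graded piece `V₊(k) = {v ∈ V₊ | dᵢ v = (Λ(dᵢ)+kᵢ) v}`. -/
def VplusGr (Λ : C.Wt) (k : Fin P.n → ℤ) : Submodule ℂ M.V :=
  M.Vplus ⊓ M.dEig (fun i => Λ.2.2 i + (k i : ℂ))

/-- `𝒵(m)` acts trivially on `V`. -/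
def Ztrivial : Prop := ∀ r, P.inΓ r → ∀ i, M.ρ (X.K r i) = 0

end TRep

/-- isomorphism of representations of `τ̃`. -/
def TRepIso {P : PreT} {C : Cartan P} {T : Torus P C} {X : Toroidal P C T}
    (M N : TRep X) : Prop :=
  ∃ e : M.V ≃ₗ[ℂ] N.V, ∀ t v, e (M.ρ t v) = N.ρ t (e v)

section LinearAlgebra

variable {V : Type*} [AddCommGroup V] [Module ℂ V]

/-- The defining relations of an `sl₂`-triple of endomorphisms (the triple may vanish). -/
structure IsSl2Ops (e f h : Module.End ℂ V) : Prop where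
  he : h * e = e * h + (2 : ℂ) • e
  hf : h * f = f * h - (2 : ℂ) • f
  ef : e * f = f * e + h

/-- Every vector is killed by a power of `u`. -/
def LocNil (u : Module.End ℂ V) : Prop := ∀ v, ∃ N : ℕ, (u ^ N) v = 0

namespace IsSl2Ops

variable {e f h : Module.End ℂ V}

lemma swap (H : IsSl2Ops e f h) : IsSl2Ops f e (-h) where
  he := by rw [neg_mul, H.hf, mul_neg]; abel
  hf := by rw [neg_mul, H.he, mul_neg]; abel
  ef := by rw [H.ef]; abel

lemma h_mul_pow_e (H : IsSl2Ops e f h) (n : ℕ) :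
    h * e ^ n = e ^ n * h + (2 * n : ℂ) • e ^ n := by
  induction n with
  | zero => simp
  | succ n ih =>
    rw [pow_succ, ← mul_assoc, ih, add_mul, mul_assoc, H.he, mul_add, mul_smul_comm, smul_mul_assoc,
      mul_assoc]
    push_cast
    module

lemma pow_e_mul_f (H : IsSl2Ops e f h) (n : ℕ) :
    e ^ (n + 1) * f = f * e ^ (n + 1) + (n + 1 : ℂ) • (e ^ n * h) + ((n + 1) * n : ℂ) • e ^ n := by
  induction n with
  | zero => simp [H.ef]
  | succ n ih =>
    rw [pow_succ' e (n + 1), mul_assoc, ih, mul_add, mul_add, ← mul_assoc, H.ef, add_mul,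
      H.h_mul_pow_e, mul_smul_comm, mul_smul_comm, ← mul_assoc e, ← pow_succ', ← mul_assoc f]
    push_cast
    module

lemma h_apply_f (H : IsSl2Ops e f h) {v : V} {μ : ℂ} (hv : h v = μ • v) :
    h (f v) = (μ - 2) • f v := by
  have := LinearMap.congr_fun H.hf v
  simp only [Module.End.mul_apply, LinearMap.sub_apply, LinearMap.smul_apply, hv, map_smul] at this
  rw [this]; module

lemma pow_e_apply_f (H : IsSl2Ops e f h) {v : V} {μ : ℂ} (hv : h v = μ • v) (n : ℕ) :
    (e ^ (n + 1)) (f v) = f ((e ^ (n + 1)) v) + ((n + 1) * (μ + n) : ℂ) • (e ^ n) v := by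
  have := LinearMap.congr_fun (H.pow_e_mul_f n) v
  simp only [Module.End.mul_apply, LinearMap.add_apply, LinearMap.smul_apply, hv, map_smul] at this
  rw [this]; module

/-- If `f` is locally nilpotent then `e ^ m` is injective on the weight space of weight `-m`. -/
lemma pow_e_injective (H : IsSl2Ops e f h) (hf : LocNil f) {m : ℕ} {v : V}
    (hv : h v = (-m : ℂ) • v) (he : (e ^ m) v = 0) : v = 0 := by
  obtain ⟨K, hK⟩ := hf v
  induction K generalizing m v with
  | zero => simpa using hK
  | succ K ih =>
    have hz : ∀ j, (e ^ (m + j)) v = 0 := fun j => by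
      rw [add_comm, pow_add, Module.End.mul_apply, he, map_zero]
    have hfv : f v = 0 := by
      refine ih (m := m + 2) (v := f v) ?_ ?_ ?_
      · rw [H.h_apply_f hv]; push_cast; congr 1; ring
      · rw [H.pow_e_apply_f hv, hz 2, hz 1]; simp
      · rwa [pow_succ] at hK
    have key : ∀ j ≤ m, (e ^ (m - j)) v = 0 := by
      intro j
      induction j with
      | zero => intro _; simpa using he
      | succ j ihj =>
        intro hj
        have h1 := ihj (by omega)
        have h2 := H.pow_e_apply_f hv (m - (j + 1))
        rw [show m - (j + 1) + 1 = m - j by omega, hfv, h1, map_zero, map_zero, zero_add] at h2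
        refine (smul_eq_zero.mp h2.symm).resolve_left (mul_ne_zero ?_ ?_)
        · exact Nat.cast_add_one_ne_zero _
        · rw [Nat.cast_sub hj]
          push_cast
          intro h3
          exact Nat.cast_add_one_ne_zero (R := ℂ) j (by linear_combination -h3)
    simpa using key m le_rfl

lemma exists_last {u : Module.End ℂ V} (hu : LocNil u) {v : V} (hv : v ≠ 0) :
    ∃ n : ℕ, (u ^ n) v ≠ 0 ∧ (u ^ (n + 1)) v = 0 := by
  classical
  have hx := hu v
  have h0 : Nat.find hx ≠ 0 := fun h => hv (by simpa [h] using Nat.find_spec hx)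
  obtain ⟨n, hn⟩ := Nat.exists_eq_succ_of_ne_zero h0
  exact ⟨n, Nat.find_min hx (by omega), by simpa [hn] using Nat.find_spec hx⟩

/-- Weights of an integrable `sl₂`-module are integers. -/
lemma weight_int (H : IsSl2Ops e f h) (he : LocNil e) (hf : LocNil f) {v : V} (hv0 : v ≠ 0)
    {μ : ℂ} (hv : h v = μ • v) : ∃ k : ℤ, μ = k := by
  obtain ⟨N, hN, hN'⟩ := exists_last he hv0
  have hw : h ((e ^ N) v) = (μ + 2 * N) • (e ^ N) v := by
    have := LinearMap.congr_fun (H.h_mul_pow_e N) v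
    simp only [Module.End.mul_apply, LinearMap.add_apply, LinearMap.smul_apply, hv,
      map_smul] at this
    rw [this]; module
  set w := (e ^ N) v
  have hew : e w = 0 := by rwa [pow_succ'] at hN'
  obtain ⟨n, hn, hn'⟩ := exists_last hf hN
  have hw' : (-h) w = (-(μ + 2 * N)) • w := by rw [LinearMap.neg_apply, hw, neg_smul]
  have h2 := H.swap.pow_e_apply_f hw' n
  rw [hew, hn', map_zero, map_zero, zero_add] at h2
  have h3 := (mul_eq_zero.mp ((smul_eq_zero.mp h2.symm).resolve_right hn)).resolve_left
    (Nat.cast_add_one_ne_zero _)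
  exact ⟨n - 2 * N, by push_cast; linear_combination -h3⟩

end IsSl2Ops

/-- `u ^ k d ^ k v = (-1) ^ k k! [d, u] ^ k v` when `u v = 0` and `u` commutes with `[d, u]`. -/
lemma pow_mul_pow_apply_of_apply_eq_zero {u u' d : Module.End ℂ V} (hd : d * u - u * d = u')
    (hc : Commute u u') {v : V} (hv : u v = 0) (k : ℕ) :
    (∀ j < k, (u ^ k) ((d ^ j) v) = 0) ∧
      (u ^ k) ((d ^ k) v) = ((-1) ^ k * k.factorial : ℂ) • (u' ^ k) v := by
  have hpow : ∀ n : ℕ, u ^ (n + 1) * d = d * u ^ (n + 1) - (n + 1 : ℂ) • (u' * u ^ n) := by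
    intro n
    induction n with
    | zero => simp [← hd]
    | succ n ih =>
      rw [pow_succ' u (n + 1), mul_assoc, ih, mul_sub, mul_smul_comm, ← mul_assoc u u', hc.eq,
        mul_assoc u', ← pow_succ', ← mul_assoc u d, show u * d = d * u - u' by rw [← hd]; abel,
        sub_mul, mul_assoc]
      push_cast
      module
  induction k with
  | zero => simp
  | succ k ih =>
    have step : ∀ j, (u ^ (k + 1)) ((d ^ (j + 1)) v) =
        d ((u ^ (k + 1)) ((d ^ j) v)) - (k + 1 : ℂ) • u' ((u ^ k) ((d ^ j) v)) := by
      intro j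
      have := LinearMap.congr_fun (hpow k) ((d ^ j) v)
      rw [pow_succ' d]
      simpa only [Module.End.mul_apply, LinearMap.sub_apply, LinearMap.smul_apply] using this
    have low : ∀ j ≤ k, (u ^ (k + 1)) ((d ^ j) v) = 0 := by
      intro j hj
      rcases hj.lt_or_eq with hj | rfl
      · rw [pow_succ', Module.End.mul_apply, ih.1 j hj, map_zero]
      · cases j with
        | zero => simp [pow_succ, hv]
        | succ j =>
          rw [pow_succ', Module.End.mul_apply, ih.2, map_smul, ← Module.End.mul_apply,
            (hc.pow_right _).eq, Module.End.mul_apply, hv, map_zero, smul_zero]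
    refine ⟨fun j hj => low j (by omega), ?_⟩
    rw [step, low k le_rfl, map_zero, ih.2, map_smul, ← Module.End.mul_apply, ← pow_succ',
      smul_smul, zero_sub, ← neg_smul]
    congr 1
    rw [Nat.factorial_succ]; push_cast; ring

/-- A locally nilpotent endomorphism is uniformly nilpotent on finite-dimensional subspaces. -/
lemma LocNil.exists_pow_of_finite {u : Module.End ℂ V} (hu : LocNil u) (W : Submodule ℂ V)
    [FiniteDimensional ℂ W] : ∃ N : ℕ, ∀ n ≥ N, ∀ v ∈ W, (u ^ n) v = 0 := by
  obtain ⟨s, hs⟩ := (Submodule.fg_iff_finiteDimensional W).mpr ‹_›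
  choose N hN using hu
  refine ⟨s.sup N, fun n hn v hv => ?_⟩
  have : W ≤ LinearMap.ker (u ^ n) := by
    rw [← hs, Submodule.span_le]
    intro x hx
    obtain ⟨c, hc⟩ := Nat.exists_eq_add_of_le ((Finset.le_sup (f := N) hx).trans hn)
    simp only [SetLike.mem_coe, LinearMap.mem_ker]
    rw [hc, add_comm, pow_add, Module.End.mul_apply, hN, map_zero]
  exact this hv

end LinearAlgebra

namespace PreT

variable {P : PreT}

lemma mem_gr {k : Fin P.n → ℤ} {x : P.g} :
    x ∈ P.gr k ↔ ∀ i, P.σ i x = P.ξ i ^ k i • x := by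
  simp [gr, Submodule.mem_iInf, sub_eq_zero]

lemma mem_gr_zero {x : P.g} : x ∈ P.gr 0 ↔ ∀ i, P.σ i x = x := by
  simp [mem_gr]

lemma gr_eq_gr_zero {r : Fin P.n → ℤ} (hr : P.inΓ r) : P.gr r = P.gr 0 := by
  ext x
  rw [mem_gr, mem_gr_zero]
  refine forall_congr' fun i => ?_
  obtain ⟨c, hc⟩ := hr i
  rw [hc, zpow_mul, zpow_natCast, (P.ξprim i).pow_eq_one, one_zpow, one_smul]

lemma lie_mem_gr_zero {x y : P.g} (hx : x ∈ P.gr 0) (hy : y ∈ P.gr 0) : ⁅x, y⁆ ∈ P.gr 0 := by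
  rw [mem_gr_zero] at *
  intro i
  rw [LieEquiv.map_lie, hx, hy]

lemma inΓ_zero : P.inΓ 0 := fun _ => dvd_zero _

lemma inΓ.add {r s : Fin P.n → ℤ} (hr : P.inΓ r) (hs : P.inΓ s) : P.inΓ (r + s) :=
  fun i => dvd_add (hr i) (hs i)

lemma inΓ.neg {r : Fin P.n → ℤ} (hr : P.inΓ r) : P.inΓ (-r) :=
  fun i => (dvd_neg (α := ℤ)).mpr (hr i)

lemma inΓ.sub {r s : Fin P.n → ℤ} (hr : P.inΓ r) (hs : P.inΓ s) : P.inΓ (r - s) :=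
  fun i => dvd_sub (hr i) (hs i)

lemma inΓ.nsmul {r : Fin P.n → ℤ} (hr : P.inΓ r) (j : ℕ) : P.inΓ (j • r) :=
  fun i => by simpa using (hr i).mul_left j

/-- The invariant form is nondegenerate on `𝔤_{0̄}`. -/
lemma exists_bil_ne_zero {x : P.g} (hx : x ∈ P.gr 0) (hx0 : x ≠ 0) :
    ∃ y ∈ P.gr 0, P.bil x y ≠ 0 := by
  classical
  rw [mem_gr_zero] at hx
  suffices ∀ S : Finset (Fin P.n), ∃ y, (∀ i ∈ S, P.σ i y = y) ∧ P.bil x y ≠ 0 by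
    obtain ⟨y, hy, hxy⟩ := this Finset.univ
    exact ⟨y, mem_gr_zero.mpr fun i => hy i (Finset.mem_univ i), hxy⟩
  intro S
  induction S using Finset.induction_on with
  | empty =>
    by_contra! h
    exact hx0 (P.bil_nondeg x fun y => h y (by simp))
  | insert i S _ ih =>
    obtain ⟨y, hy, hxy⟩ := ih
    have hbil : ∀ j : ℕ, P.bil x ((fun z => P.σ i z)^[j] y) = P.bil x y := by
      intro j
      induction j with
      | zero => rfl
      | succ j ih =>
        rw [Function.iterate_succ_apply', ← ih]
        conv_lhs => rw [← hx i]
        exact P.bil_aut i _ _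
    have hfix : ∀ l ∈ S, ∀ j : ℕ, P.σ l ((fun z => P.σ i z)^[j] y) = (fun z => P.σ i z)^[j] y := by
      intro l hl j
      induction j with
      | zero => exact hy l hl
      | succ j ih => rw [Function.iterate_succ_apply', P.σcomm, ih]
    refine ⟨∑ j ∈ Finset.range (P.m i), (fun z => P.σ i z)^[j] y, fun l hl => ?_, ?_⟩
    · rw [map_sum]
      rcases Finset.mem_insert.mp hl with rfl | hl
      · have h1 := Finset.sum_range_succ' (fun j => (fun z => P.σ l z)^[j] y) (P.m l)
        rw [Finset.sum_range_succ, P.σord] at h1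
        simp only [Function.iterate_zero, id] at h1
        simpa only [← Function.iterate_succ_apply'] using (add_right_cancel h1).symm
      · exact Finset.sum_congr rfl fun j _ => hfix l hl j
    · rw [map_sum, Finset.sum_congr rfl fun j _ => hbil j]
      simp [hxy, (P.mpos i).ne']

end PreT

/-- An `sl₂`-triple in `𝔤_{0̄}` adapted to the Cartan subalgebra `𝔥_{0̄}`. -/
structure Cartan.Triple {P : PreT} (C : Cartan P) where
  e : P.g
  f : P.g
  h : ↥C.h0
  α : Module.Dual ℂ ↥C.h0
  α_ne : α ≠ 0
  e_mem : e ∈ C.wtg 0 α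
  f_mem : f ∈ C.wtg 0 (-α)
  h_ne : (h : P.g) ≠ 0
  lie_ef : ⁅e, f⁆ = (h : P.g)
  lie_he : ⁅(h : P.g), e⁆ = (2 : ℂ) • e
  lie_hf : ⁅(h : P.g), f⁆ = -((2 : ℂ) • f)

namespace Cartan

variable {P : PreT} {C : Cartan P}

lemma lie_eq_smul_of_mem_wtg {k : Fin P.n → ℤ} {α : Module.Dual ℂ ↥C.h0} {x : P.g}
    (hx : x ∈ C.wtg k α) (h : ↥C.h0) : ⁅(h : P.g), x⁆ = α h • x := by
  have hx' : x ∈ C.wtfull α := hx.2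
  rw [wtfull, Submodule.mem_iInf] at hx'
  simpa [sub_eq_zero] using hx' h

lemma rootFn_add (α β : Module.Dual ℂ ↥C.h0) (k l : Fin P.n → ℤ) :
    C.rootFn α k + C.rootFn β l = C.rootFn (α + β) (k + l) := by
  simp only [rootFn, Prod.mk_add_mk, add_zero]
  congr 2
  ext i
  simp

lemma nsmul_rootFn (m : ℕ) (α : Module.Dual ℂ ↥C.h0) (k : Fin P.n → ℤ) :
    m • C.rootFn α k = C.rootFn (m • α) (m • k) := by
  simp only [rootFn, Prod.smul_mk, smul_zero]
  congr 2
  ext i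
  simp

lemma rootFn_zero_zero : C.rootFn 0 0 = 0 := by
  simp only [rootFn]
  congr 2
  ext i
  simp

/-- The opposite triple `(f, e, -h)`. -/
def Triple.swap (S : C.Triple) : C.Triple where
  e := S.f
  f := S.e
  h := -S.h
  α := -S.α
  α_ne := neg_ne_zero.mpr S.α_ne
  e_mem := S.f_mem
  f_mem := by rw [neg_neg]; exact S.e_mem
  h_ne := by simpa using S.h_ne
  lie_ef := by rw [← lie_skew, S.lie_ef]; rfl
  lie_he := by rw [Submodule.coe_neg, neg_lie, S.lie_hf, neg_neg]
  lie_hf := by rw [Submodule.coe_neg, neg_lie, S.lie_he]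

end Cartan

namespace Torus

variable {P : PreT} {C : Cartan P}

/-- `𝔤_{0̄}` as a Lie subalgebra of `𝔤`. -/
def grZero (P : PreT) : LieSubalgebra ℂ P.g where
  __ := P.gr 0
  lie_mem' hx hy := PreT.lie_mem_gr_zero hx hy

/-- `𝔥_{0̄}` as a Lie subalgebra of `𝔤_{0̄}`. -/
def cartanSub (C : Cartan P) : LieSubalgebra ℂ ↥(grZero P) where
  __ := C.h0.comap (grZero P).toSubmodule.subtype
  lie_mem' {x y} hx hy := by
    change ⁅(x : P.g), (y : P.g)⁆ ∈ C.h0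
    have h0 : ⁅(x : P.g), (y : P.g)⁆ = 0 := C.h0_abelian _ hx _ hy
    rw [h0]
    exact zero_mem _

/-- The inclusion of `𝔥_{0̄}` in `𝔤_{0̄}`, with values in `cartanSub C`. -/
def toCartanSub (C : Cartan P) : ↥C.h0 →ₗ[ℂ] ↥(cartanSub C) where
  toFun h := ⟨⟨h, C.h0_le h.2⟩, h.2⟩
  map_add' _ _ := rfl
  map_smul' _ _ := rfl

lemma isSimple_grZero (T : Torus P C) : LieAlgebra.IsSimple ℂ ↥(grZero P) where
  eq_bot_or_eq_top I := by
    have h := T.g0_ideals (I.toSubmodule.map (grZero P).toSubmodule.subtype) ?_ ?_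
    · rcases h with h | h
      · left
        rw [eq_bot_iff]
        intro x hx
        have : (x : P.g) ∈ I.toSubmodule.map (grZero P).toSubmodule.subtype := ⟨x, hx, rfl⟩
        rw [h, Submodule.mem_bot] at this
        exact (LieSubmodule.mem_bot x).mpr (Subtype.ext this)
      · right
        rw [eq_top_iff]
        intro x _
        have : (x : P.g) ∈ I.toSubmodule.map (grZero P).toSubmodule.subtype := by
          rw [h]; exact x.2
        obtain ⟨y, hy, hyx⟩ := this
        rwa [← Subtype.ext hyx]
    · rintro _ ⟨y, _, rfl⟩
      exact y.2
    · rintro x hx _ ⟨y, hy, rfl⟩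
      exact ⟨⁅(⟨x, hx⟩ : ↥(grZero P)), y⁆, lie_mem_right ℂ _ I _ _ hy, rfl⟩
  non_abelian h := by
    obtain ⟨x, hx, y, hy, hxy⟩ := T.g0_nonabelian
    exact hxy (congrArg Subtype.val
      (h.trivial (⟨x, hx⟩ : ↥(grZero P)) (⟨y, hy⟩ : ↥(grZero P))))

lemma isCartanSubalgebra_cartanSub (C : Cartan P) : (cartanSub C).IsCartanSubalgebra where
  nilpotent := by
    have : IsLieAbelian ↥(cartanSub C) :=
      ⟨fun x y => Subtype.ext (Subtype.ext (C.h0_abelian _ x.2 _ y.2))⟩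
    infer_instance
  self_normalizing := by
    refine le_antisymm (fun x hx => ?_) (LieSubalgebra.le_normalizer _)
    rw [LieSubalgebra.mem_normalizer_iff'] at hx
    exact C.h0_selfnorm x x.2 fun h hh => hx ⟨h, C.h0_le hh⟩ hh

lemma nonempty_triple (T : Torus P C) : Nonempty C.Triple := by
  have := P.gfin
  have := T.isSimple_grZero
  have := isCartanSubalgebra_cartanSub C
  have hne : Nontrivial ↥(cartanSub C) := by
    obtain ⟨x, hx, hx0⟩ := (Submodule.ne_bot_iff _).mp C.h0_ne
    refine ⟨⟨toCartanSub C ⟨x, hx⟩, 0, fun h => hx0 ?_⟩⟩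
    exact congrArg (fun z : ↥(cartanSub C) => ((z : ↥(grZero P)) : P.g)) h
  obtain ⟨α, hα⟩ : ∃ α : LieModule.Weight ℂ ↥(cartanSub C) ↥(grZero P), α.IsNonZero := by
    by_contra! hcon
    have h := LieAlgebra.IsKilling.span_weight_isNonZero_eq_top ℂ ↥(grZero P) (cartanSub C)
    have hempty : {α : LieModule.Weight ℂ ↥(cartanSub C) ↥(grZero P) | α.IsNonZero} = ∅ :=
      Set.eq_empty_of_forall_notMem fun α h => h (hcon α)
    rw [hempty, Set.image_empty, Submodule.span_empty] at h
    exact bot_ne_top h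
  obtain ⟨h, e, f, ht, he, hf⟩ :=
    LieAlgebra.IsKilling.exists_isSl2Triple_of_weight_isNonZero hα
  have hh : h ∈ cartanSub C := by
    rw [IsSl2Triple.h_eq_coroot hα ht he hf]
    exact (LieAlgebra.IsKilling.coroot α).2
  have heig : ∀ {β : ↥(cartanSub C) → ℂ} {x : ↥(grZero P)},
      x ∈ LieAlgebra.rootSpace (cartanSub C) β → ∀ k : ↥C.h0,
        ⁅(k : P.g), (x : P.g)⁆ = β (toCartanSub C k) • (x : P.g) := fun hx k =>
    congrArg Subtype.val (LieAlgebra.IsKilling.lie_eq_smul_of_mem_rootSpace hx (toCartanSub C k))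
  have hwt : ∀ {β : Module.Dual ℂ ↥C.h0} {x : ↥(grZero P)},
      (∀ k : ↥C.h0, ⁅(k : P.g), (x : P.g)⁆ = β k • (x : P.g)) → (x : P.g) ∈ C.wtg 0 β := by
    intro β x hx
    refine ⟨x.2, ?_⟩
    change (x : P.g) ∈ C.wtfull β
    rw [Cartan.wtfull, Submodule.mem_iInf]
    intro k
    simp [hx k]
  refine ⟨{ e := e, f := f, h := ⟨h, hh⟩, α := α.toLinear ∘ₗ toCartanSub C, α_ne := ?_,
            e_mem := hwt fun k => heig he k, f_mem := hwt fun k => heig hf k, h_ne := ?_,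
            lie_ef := congrArg Subtype.val ht.lie_e_f, lie_he := ?_, lie_hf := ?_ }⟩
  · intro h0
    refine hα (funext fun k => ?_)
    exact LinearMap.congr_fun h0 ⟨k.1.1, k.2⟩
  · exact fun h0 => ht.h_ne_zero (Subtype.ext h0)
  · simpa using congrArg Subtype.val (ht.lie_h_e_smul ℂ)
  · simpa using congrArg Subtype.val (ht.lie_lie_smul_f ℂ)

end Torus

namespace TRep

variable {P : PreT} {C : Cartan P} {T : Torus P C} {X : Toroidal P C T} (M : TRep X)

lemma mem_wtSp {w : C.Wt} {v : M.V} : v ∈ M.wtSp w ↔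
    (∀ h : ↥C.h0, M.ρ (X.E 0 (h : P.g)) v = w.1 h • v) ∧
      (∀ i, M.ρ (X.K 0 i) v = w.2.1 i • v) ∧ ∀ i, M.ρ (X.Dop 0 i) v = w.2.2 i • v := by
  simp [wtSp, sub_eq_zero, and_assoc]

/-- A subspace stable under the generators of `τ̃` is a submodule. -/
lemma Irr.eq_bot_or_eq_top {M : TRep X} (hirr : M.Irr) (U : Submodule ℂ M.V)
    (hE : ∀ k x, x ∈ P.gr k → ∀ v ∈ U, M.ρ (X.E k x) v ∈ U)
    (hK : ∀ r i, P.inΓ r → ∀ v ∈ U, M.ρ (X.K r i) v ∈ U)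
    (hD : ∀ r i, P.inΓ r → ∀ v ∈ U, M.ρ (X.Dop r i) v ∈ U) : U = ⊥ ∨ U = ⊤ := by
  refine hirr.2 U fun t v hv => ?_
  have ht : t ∈ Submodule.span ℂ
    ({t | ∃ k x, x ∈ P.gr k ∧ t = X.E k x} ∪ {t | ∃ r i, P.inΓ r ∧ t = X.K r i} ∪
      {t | ∃ r i, P.inΓ r ∧ t = X.Dop r i}) := by rw [X.span_top]; trivial
  induction ht using Submodule.span_induction with
  | mem t ht =>
    rcases ht with (⟨k, x, hx, rfl⟩ | ⟨r, i, hr, rfl⟩) | ⟨r, i, hr, rfl⟩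
    · exact hE k x hx v hv
    · exact hK r i hr v hv
    · exact hD r i hr v hv
  | zero => simp
  | add a b _ _ ha hb => simpa using add_mem ha hb
  | smul c a _ ha => simpa using U.smul_mem c ha

lemma ρ_comm_apply (a b : X.τ) (v : M.V) : M.ρ a (M.ρ b v) = M.ρ b (M.ρ a v) + M.ρ ⁅a, b⁆ v := by
  rw [M.ρ_lie]; simp

/-- Homogeneous elements of `τ̃` shift weights. -/
lemma apply_mem_wtSp {t : X.τ} {α : Module.Dual ℂ ↥C.h0} {k : Fin P.n → ℤ}
    (h1 : ∀ h : ↥C.h0, M.ρ ⁅X.E 0 (h : P.g), t⁆ = α h • M.ρ t)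
    (h2 : ∀ i, M.ρ ⁅X.K 0 i, t⁆ = 0) (h3 : ∀ i, M.ρ ⁅X.Dop 0 i, t⁆ = (k i : ℂ) • M.ρ t)
    {w : C.Wt} {v : M.V} (hv : v ∈ M.wtSp w) : M.ρ t v ∈ M.wtSp (w + C.rootFn α k) := by
  rw [mem_wtSp] at hv ⊢
  refine ⟨fun h => ?_, fun i => ?_, fun i => ?_⟩
  · rw [ρ_comm_apply, hv.1, h1, map_smul, LinearMap.smul_apply, ← add_smul]
    simp [Cartan.rootFn]
  · rw [ρ_comm_apply, hv.2.1, h2, map_smul]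
    simp [Cartan.rootFn]
  · rw [ρ_comm_apply, hv.2.2, h3, map_smul, LinearMap.smul_apply, ← add_smul]
    simp [Cartan.rootFn]

lemma pow_apply_mem_wtSp {u : Module.End ℂ M.V} {α : Module.Dual ℂ ↥C.h0} {k : Fin P.n → ℤ}
    (hu : ∀ (w : C.Wt), ∀ v ∈ M.wtSp w, u v ∈ M.wtSp (w + C.rootFn α k))
    (m : ℕ) {w : C.Wt} {v : M.V} (hv : v ∈ M.wtSp w) :
    (u ^ m) v ∈ M.wtSp (w + C.rootFn (m • α) (m • k)) := by
  rw [← C.nsmul_rootFn]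
  induction m with
  | zero => simpa using hv
  | succ m ih =>
    rw [pow_succ', Module.End.mul_apply, succ_nsmul, ← add_assoc]
    exact hu _ _ ih

lemma ρ_lie_E_zero_E (X : Toroidal P C T) {k : Fin P.n → ℤ} {x y : P.g} (hx : x ∈ P.gr 0)
    (hy : y ∈ P.gr k) : ⁅X.E 0 x, X.E k y⁆ = X.E k ⁅x, y⁆ := by
  rw [X.br_EE 0 k x y hx hy]
  simp

lemma E_apply_mem_wtSp {k : Fin P.n → ℤ} {α : Module.Dual ℂ ↥C.h0} {x : P.g}
    (hx : x ∈ C.wtg k α) {w : C.Wt} {v : M.V} (hv : v ∈ M.wtSp w) :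
    M.ρ (X.E k x) v ∈ M.wtSp (w + C.rootFn α k) := by
  refine M.apply_mem_wtSp (fun h => ?_) (fun i => ?_) (fun i => ?_) hv
  · rw [ρ_lie_E_zero_E X (C.h0_le h.2) hx.1, Cartan.lie_eq_smul_of_mem_wtg hx, map_smul, map_smul]
  · rw [← lie_skew, X.br_EK k x hx.1]; simp
  · rw [X.br_DE 0 P.inΓ_zero i k x hx.1, zero_add, map_smul]

lemma Dop_apply_mem_wtSp {M : TRep X} (hlz : M.LevelZero) {r : Fin P.n → ℤ} (hr : P.inΓ r)
    (j : Fin P.n) {w : C.Wt} {v : M.V} (hv : v ∈ M.wtSp w) :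
    M.ρ (X.Dop r j) v ∈ M.wtSp (w + C.rootFn 0 r) := by
  refine M.apply_mem_wtSp (fun h => ?_) (fun i => ?_) (fun i => ?_) hv
  · rw [← lie_skew, X.br_DE r hr j 0 h (C.h0_le h.2)]; simp
  · rw [M.ρ_lie, hlz i]; simp
  · rw [X.br_DD 0 r P.inΓ_zero hr]; simp

lemma K_apply_mem_wtSp {r : Fin P.n → ℤ} (hr : P.inΓ r)
    (j : Fin P.n) {w : C.Wt} {v : M.V} (hv : v ∈ M.wtSp w) :
    M.ρ (X.K r j) v ∈ M.wtSp (w + C.rootFn 0 r) := by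
  refine M.apply_mem_wtSp (fun h => ?_) (fun i => ?_) (fun i => ?_) hv
  · rw [X.br_EK 0 h (C.h0_le h.2)]; simp
  · rw [X.br_KK]; simp
  · rw [X.br_DK 0 r P.inΓ_zero hr]; simp

/-- The associative algebra of operators on `V` generated by `𝒵(m)`. -/
def zAlg : Subalgebra ℂ (Module.End ℂ M.V) :=
  Algebra.adjoin ℂ (Set.range fun p : (Fin P.n → ℤ) × Fin P.n => M.ρ (X.K p.1 p.2))

variable {M}

lemma K_mem_zAlg (r : Fin P.n → ℤ) (i : Fin P.n) : M.ρ (X.K r i) ∈ M.zAlg :=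
  Algebra.subset_adjoin ⟨(r, i), rfl⟩

lemma commute_of_mem_zAlg {a u : Module.End ℂ M.V} (ha : ∀ r i, Commute a (M.ρ (X.K r i)))
    (hu : u ∈ M.zAlg) : Commute a u := by
  refine (Subalgebra.mem_centralizer_iff ℂ).mp
    (Algebra.adjoin_le (S := Subalgebra.centralizer ℂ {a}) ?_ hu) a rfl
  rintro _ ⟨p, rfl⟩
  exact (Subalgebra.mem_centralizer_iff ℂ).mpr fun b hb => by
    rw [Set.mem_singleton_iff.mp hb]; exact ha _ _

lemma commute_of_lie_eq_zero {a b : X.τ} (h : ⁅a, b⁆ = 0) : Commute (M.ρ a) (M.ρ b) := by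
  have := M.ρ_lie a b
  rw [h, map_zero] at this
  exact (sub_eq_zero.mp this.symm)

lemma E_commute_zAlg {k : Fin P.n → ℤ} {x : P.g} (hx : x ∈ P.gr k) {u : Module.End ℂ M.V}
    (hu : u ∈ M.zAlg) : Commute (M.ρ (X.E k x)) u :=
  commute_of_mem_zAlg (fun r i => commute_of_lie_eq_zero (X.br_EK k x hx r i)) hu

lemma zAlg_commute {u u' : Module.End ℂ M.V} (hu : u ∈ M.zAlg) (hu' : u' ∈ M.zAlg) :
    Commute u u' :=
  commute_of_mem_zAlg (fun r i => (commute_of_mem_zAlg (fun s j =>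
    commute_of_lie_eq_zero (X.br_KK r s i j)) hu).symm) hu'

/-- `zAlg` is stable under the derivations induced by `𝒟(m)`. -/
lemma lie_Dop_mem_zAlg {r : Fin P.n → ℤ} (hr : P.inΓ r) (j : Fin P.n) {u : Module.End ℂ M.V}
    (hu : u ∈ M.zAlg) : M.ρ (X.Dop r j) * u - u * M.ρ (X.Dop r j) ∈ M.zAlg := by
  induction hu using Algebra.adjoin_induction with
  | mem u hu =>
    obtain ⟨⟨s, i⟩, rfl⟩ := hu
    simp only
    by_cases hs : P.inΓ s
    · rw [← M.ρ_lie, X.br_DK r s hr hs]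
      simp only [map_add, map_smul, map_sum]
      exact add_mem (Subalgebra.smul_mem _ (K_mem_zAlg _ _) _) (Subalgebra.smul_mem _
        (Subalgebra.sum_mem _ fun p _ => Subalgebra.smul_mem _ (K_mem_zAlg _ _) _) _)
    · simp [X.K_not s i hs]
  | algebraMap c => rw [(Algebra.commutes c _).symm, sub_self]; exact zero_mem _
  | add u u' _ _ hu hu' => convert add_mem hu hu' using 1; noncomm_ring
  | mul u u' hum hum' hu hu' =>
    convert add_mem (mul_mem hu hum') (mul_mem hum hu') using 1; noncomm_ring

/-- In an irreducible module, an element of `zAlg` with a kernel is locally nilpotent. -/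
lemma Irr.locNil (hirr : M.Irr) {u : Module.End ℂ M.V} (hu : u ∈ M.zAlg) {v : M.V}
    (hv0 : v ≠ 0) (hv : u v = 0) : LocNil u := by
  have key := hirr.eq_bot_or_eq_top (Module.End.maxGenEigenspace u 0) ?_ ?_ ?_
  · rcases key with h | h
    · refine absurd ((Submodule.mem_bot ℂ).mp (h ▸ ?_ : v ∈ (⊥ : Submodule ℂ M.V))) hv0
      exact (Module.End.mem_maxGenEigenspace _ _ _).mpr ⟨1, by simpa using hv⟩
    · intro x
      have hx : x ∈ Module.End.maxGenEigenspace u 0 := h ▸ Submodule.mem_top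
      simpa using (Module.End.mem_maxGenEigenspace _ _ _).mp hx
  · intro k x hx v hv
    exact Module.End.mapsTo_maxGenEigenspace_of_comm (E_commute_zAlg hx hu).symm 0 hv
  · intro r i _ v hv
    exact Module.End.mapsTo_maxGenEigenspace_of_comm (zAlg_commute hu (K_mem_zAlg r i)) 0 hv
  · intro r j hr v hv
    have hd := lie_Dop_mem_zAlg hr j hu
    set d := M.ρ (X.Dop r j)
    rw [Module.End.mem_maxGenEigenspace] at hv ⊢
    obtain ⟨N, hN⟩ := hv
    rw [zero_smul, sub_zero] at hN ⊢
    have hpow := lie_Dop_mem_zAlg hr j (pow_mem hu N)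
    refine ⟨N + N, ?_⟩
    have h1 : (u ^ N) (d v) = -((d * u ^ N - u ^ N * d) v) := by
      simp [LinearMap.sub_apply, Module.End.mul_apply, hN]
    rw [pow_add, Module.End.mul_apply, h1, map_neg, ← Module.End.mul_apply,
      (zAlg_commute (pow_mem hu N) hpow).eq, Module.End.mul_apply, hN, map_zero, neg_zero]

end TRep

namespace TRep

variable {P : PreT} {C : Cartan P} {T : Torus P C} {X : Toroidal P C T} {M : TRep X}

lemma triple_e_mem (S : C.Triple) {r : Fin P.n → ℤ} (hr : P.inΓ r) : S.e ∈ C.wtg r S.α := by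
  have := S.e_mem
  rwa [Cartan.wtg, ← PreT.gr_eq_gr_zero hr] at this

lemma triple_f_mem (S : C.Triple) {r : Fin P.n → ℤ} (hr : P.inΓ r) : S.f ∈ C.wtg r (-S.α) :=
  triple_e_mem S.swap hr

/-- At level zero, `e ⊗ t^r` and `f ⊗ t^{-r}` span with `h` a copy of `sl₂`. -/
lemma LevelZero.isSl2Ops (hlz : M.LevelZero) (S : C.Triple) {r : Fin P.n → ℤ} (hr : P.inΓ r) :
    IsSl2Ops (M.ρ (X.E r S.e)) (M.ρ (X.E (-r) S.f)) (M.ρ (X.E 0 (S.h : P.g))) where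
  he := by
    rw [← sub_eq_iff_eq_add', ← M.ρ_lie, ρ_lie_E_zero_E X (C.h0_le S.h.2) (triple_e_mem S hr).1,
      S.lie_he, map_smul, map_smul]
  hf := by
    rw [sub_eq_add_neg, ← sub_eq_iff_eq_add', ← M.ρ_lie,
      ρ_lie_E_zero_E X (C.h0_le S.h.2) (triple_f_mem S hr.neg).1,
      S.lie_hf, map_neg, map_neg, map_smul, map_smul]
  ef := by
    rw [← sub_eq_iff_eq_add', ← M.ρ_lie, X.br_EE _ _ _ _ (triple_e_mem S hr).1
      (triple_f_mem S hr.neg).1, S.lie_ef, add_neg_cancel]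
    simp [hlz _]

lemma Integrable.locNil_e (hint : M.Integrable) (S : C.Triple) {r : Fin P.n → ℤ}
    (hr : P.inΓ r) : LocNil (M.ρ (X.E r S.e)) :=
  hint.2 r S.α S.α_ne S.e (triple_e_mem S hr)

lemma Integrable.locNil_f (hint : M.Integrable) (S : C.Triple) {r : Fin P.n → ℤ}
    (hr : P.inΓ r) : LocNil (M.ρ (X.E r S.f)) :=
  hint.locNil_e S.swap hr

/-- Translations by `m • s`, `s ∈ Γ`, on weight spaces of `sl₂`-weight `m`: they commute with
`zAlg` and are injective. -/
lemma exists_translation (hlz : M.LevelZero) (hint : M.Integrable) (S : C.Triple) {m : ℕ}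
    {w : C.Wt} (hw : w.1 S.h = m) {s : Fin P.n → ℤ} (hs : P.inΓ s) :
    ∃ t : Module.End ℂ M.V, (∀ u ∈ M.zAlg, Commute t u) ∧
      ∀ v ∈ M.wtSp w, t v ∈ M.wtSp (w + C.rootFn 0 (m • s)) ∧ (t v = 0 → v = 0) := by
  have hΓ := PreT.inΓ_zero (P := P)
  refine ⟨M.ρ (X.E s S.e) ^ m * M.ρ (X.E 0 S.f) ^ m, fun u hu => ?_, fun v hv => ⟨?_, fun h0 => ?_⟩⟩
  · exact ((E_commute_zAlg (triple_e_mem S hs).1 hu).pow_left m).mul_left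
      ((E_commute_zAlg (triple_f_mem S hΓ).1 hu).pow_left m)
  · have h1 := M.pow_apply_mem_wtSp
      (fun w v => M.E_apply_mem_wtSp (triple_f_mem S hΓ) (w := w) (v := v)) m hv
    have h2 := M.pow_apply_mem_wtSp
      (fun w v => M.E_apply_mem_wtSp (triple_e_mem S hs) (w := w) (v := v)) m h1
    rwa [add_assoc, Cartan.rootFn_add, smul_neg, neg_add_cancel, smul_zero, zero_add] at h2
  · have h1 := hlz.isSl2Ops S hΓ
    rw [neg_zero] at h1
    have hwt : M.ρ (X.E 0 (S.h : P.g)) v = (m : ℂ) • v := by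
      rw [← hw]; exact (M.mem_wtSp.mp hv).1 S.h
    have hwt' : (-M.ρ (X.E 0 (S.h : P.g))) v = (-m : ℂ) • v := by
      rw [LinearMap.neg_apply, hwt, neg_smul]
    refine h1.swap.pow_e_injective (hint.locNil_e S hΓ) hwt' ?_
    refine (hlz.isSl2Ops S hs).pow_e_injective (m := m) (hint.locNil_f S hs.neg) ?_ h0
    have h2 := LinearMap.congr_fun (h1.swap.h_mul_pow_e m) v
    simp only [Module.End.mul_apply, LinearMap.add_apply, LinearMap.smul_apply, hwt',
      map_smul] at h2
    rw [LinearMap.neg_apply, neg_eq_iff_eq_neg] at h2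
    rw [h2]
    module

/-- The translations are surjective when the weight spaces are finite-dimensional. -/
lemma exists_translation_surjective (hlz : M.LevelZero) (hint : M.Integrable) (hfin : M.FinWt)
    (S : C.Triple) {m : ℕ} {w : C.Wt} (hw : w.1 S.h = m) {s : Fin P.n → ℤ} (hs : P.inΓ s) :
    ∃ t : Module.End ℂ M.V, (∀ u ∈ M.zAlg, Commute t u) ∧
      ∀ y ∈ M.wtSp (w + C.rootFn 0 (m • s)), ∃ v ∈ M.wtSp w, t v = y := by
  have hle : ∀ (w : C.Wt) (s : Fin P.n → ℤ), w.1 S.h = m → P.inΓ s →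
      ∃ t : Module.End ℂ M.V, (∀ u ∈ M.zAlg, Commute t u) ∧
        ∃ t' : ↥(M.wtSp w) →ₗ[ℂ] ↥(M.wtSp (w + C.rootFn 0 (m • s))),
          (∀ v, (t' v : M.V) = t v) ∧ Function.Injective t' := by
    intro w s hw hs
    obtain ⟨t, ht, htw⟩ := exists_translation hlz hint S hw hs
    refine ⟨t, ht, t.restrict fun v hv => (htw v hv).1, fun v => rfl, ?_⟩
    rw [← LinearMap.ker_eq_bot, LinearMap.ker_eq_bot']
    exact fun v hv => Subtype.ext ((htw v v.2).2 (congrArg Subtype.val hv))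
  obtain ⟨t, ht, t', htt', hinj⟩ := hle w s hw hs
  obtain ⟨_, _, t₂, _, hinj₂⟩ := hle (w + C.rootFn 0 (m • s)) (-s) (by simpa [Cartan.rootFn]) hs.neg
  have hback : w + C.rootFn 0 (m • s) + C.rootFn 0 (m • -s) = w := by
    rw [add_assoc, Cartan.rootFn_add, add_zero, smul_neg, add_neg_cancel, Cartan.rootFn_zero_zero,
      add_zero]
  have := hfin w
  have := hfin (w + C.rootFn 0 (m • s))
  have := hfin (w + C.rootFn 0 (m • s) + C.rootFn 0 (m • -s))
  have h1 := LinearMap.finrank_le_finrank_of_injective hinj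
  have h2 := LinearMap.finrank_le_finrank_of_injective hinj₂
  rw [hback] at h2
  have hsurj := (LinearMap.injective_iff_surjective_of_finrank_eq_finrank (le_antisymm h1 h2)).mp
    hinj
  refine ⟨t, ht, fun y hy => ?_⟩
  obtain ⟨v, hv⟩ := hsurj ⟨y, hy⟩
  exact ⟨v, v.2, by rw [← htt', hv]⟩

/-- Local nilpotency in `zAlg` is inherited by the derivatives along `𝒟(m)`. -/
lemma locNil_lie_Dop (hirr : M.Irr) (hint : M.Integrable) (hlz : M.LevelZero) (hfin : M.FinWt)
    (S : C.Triple) {m : ℕ} (hm : 0 < m) {w : C.Wt} (hw : w.1 S.h = m) {u : Module.End ℂ M.V}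
    (hu : u ∈ M.zAlg) (hnil : LocNil u) {v : M.V} (hv : v ∈ M.wtSp w) (hv0 : v ≠ 0)
    (huv : u v = 0) {s : Fin P.n → ℤ} (hs : P.inΓ s) (j : Fin P.n) :
    LocNil (M.ρ (X.Dop s j) * u - u * M.ρ (X.Dop s j)) := by
  have := hfin w
  obtain ⟨N, hN⟩ := hnil.exists_pow_of_finite (M.wtSp w)
  have hu' := lie_Dop_mem_zAlg hs j hu
  set u' := M.ρ (X.Dop s j) * u - u * M.ρ (X.Dop s j) with hu'_def
  have hk := (pow_mul_pow_apply_of_apply_eq_zero hu'_def.symm (zAlg_commute hu hu') huv (m * N)).2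
  have hd := M.pow_apply_mem_wtSp
    (fun w v => Dop_apply_mem_wtSp hlz hs j (w := w) (v := v)) (m * N) hv
  rw [smul_zero, mul_smul] at hd
  obtain ⟨t, ht, htsurj⟩ := exists_translation_surjective hlz hint hfin S hw (hs.nsmul N)
  obtain ⟨y, hy, hty⟩ := htsurj _ hd
  have hzero : (u ^ (m * N)) ((M.ρ (X.Dop s j) ^ (m * N)) v) = 0 := by
    rw [← hty, ← Module.End.mul_apply, ← (ht _ (pow_mem hu _)).eq, Module.End.mul_apply,
      hN _ (Nat.le_mul_of_pos_left N hm) y hy, map_zero]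
  rw [hzero] at hk
  have hpow := (smul_eq_zero.mp hk.symm).resolve_left
    (mul_ne_zero (pow_ne_zero _ (by simp)) (Nat.cast_ne_zero.mpr (Nat.factorial_ne_zero _)))
  have hnil' := hirr.locNil (pow_mem hu' (m * N)) hv0 hpow
  intro x
  obtain ⟨n, hn⟩ := hnil' x
  exact ⟨m * N * n, by rwa [pow_mul]⟩

end TRep

namespace TRep

variable {P : PreT} {C : Cartan P} {T : Torus P C} {X : Toroidal P C T} {M : TRep X}

/-- For `r ∈ Γ`, the subspace `𝔤_{0̄} ⊗ t^r` acts either faithfully or by zero. -/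
lemma ρ_E_eq_zero_of_exists {r : Fin P.n → ℤ} (hr : P.inΓ r)
    (h : ∃ x ∈ P.gr 0, x ≠ 0 ∧ M.ρ (X.E r x) = 0) : ∀ x ∈ P.gr 0, M.ρ (X.E r x) = 0 := by
  obtain ⟨x, hx, hx0, hρ⟩ := h
  have hideal : ∀ y ∈ P.gr 0, ∀ u ∈ P.gr 0 ⊓ LinearMap.ker (M.ρ ∘ₗ X.E r),
      ⁅y, u⁆ ∈ P.gr 0 ⊓ LinearMap.ker (M.ρ ∘ₗ X.E r) := by
    intro y hy u hu
    have hu2 : M.ρ (X.E r u) = 0 := by simpa using hu.2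
    refine ⟨PreT.lie_mem_gr_zero hy hu.1, ?_⟩
    simp only [SetLike.mem_coe, LinearMap.mem_ker, LinearMap.comp_apply]
    rw [← ρ_lie_E_zero_E X hy (by rw [PreT.gr_eq_gr_zero hr]; exact hu.1), M.ρ_lie, hu2]
    simp
  rcases T.g0_ideals _ inf_le_left hideal with h | h
  · exact absurd ((Submodule.mem_bot ℂ).mp (h ▸ ⟨hx, by simpa using hρ⟩)) hx0
  · intro y hy
    have hy' : y ∈ LinearMap.ker (M.ρ ∘ₗ X.E r) := (h.symm ▸ hy : y ∈ P.gr 0 ⊓ _).2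
    simpa using hy'

/-- If a nonzero element of `𝔤_{0̄}` acts by zero then so does `𝒵(m)`. -/
lemma ztrivial_of_exists_ρ_E_eq_zero (h : ∃ x ∈ P.gr 0, x ≠ 0 ∧ M.ρ (X.E 0 x) = 0) :
    M.Ztrivial := by
  have h0 := ρ_E_eq_zero_of_exists PreT.inΓ_zero h
  obtain ⟨x, hx, y, hy, hxy⟩ := T.g0_nonabelian
  have hall : ∀ r, P.inΓ r → ∀ z ∈ P.gr 0, M.ρ (X.E r z) = 0 := fun r hr =>
    ρ_E_eq_zero_of_exists hr ⟨⁅x, y⁆, PreT.lie_mem_gr_zero hx hy, hxy, by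
      rw [← ρ_lie_E_zero_E X hx (by rw [PreT.gr_eq_gr_zero hr]; exact hy), M.ρ_lie, h0 x hx]
      simp⟩
  intro t ht i
  obtain ⟨z, hz, hxz⟩ := PreT.exists_bil_ne_zero (PreT.lie_mem_gr_zero hx hy) hxy
  have hr : P.inΓ (Pi.single i (P.m i : ℤ)) := fun j => by
    by_cases hj : j = i
    · subst hj; simp
    · simp [Pi.single_eq_of_ne hj]
  have hbr := X.br_EE (Pi.single i (P.m i : ℤ)) (t - Pi.single i (P.m i : ℤ)) ⁅x, y⁆ z
    (by rw [PreT.gr_eq_gr_zero hr]; exact PreT.lie_mem_gr_zero hx hy)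
    (by rw [PreT.gr_eq_gr_zero (ht.sub hr)]; exact hz)
  have hρ := congrArg M.ρ hbr
  rw [add_sub_cancel, M.ρ_lie, hall _ hr _ (PreT.lie_mem_gr_zero hx hy), zero_mul, mul_zero,
    sub_self, map_add, hall _ ht _ (PreT.lie_mem_gr_zero (PreT.lie_mem_gr_zero hx hy) hz), zero_add,
    map_smul, Finset.sum_eq_single i (fun j _ hj => by simp [Pi.single_eq_of_ne hj]) (by simp),
    Pi.single_eq_same, map_smul] at hρ
  refine (smul_eq_zero.mp ((smul_eq_zero.mp hρ.symm).resolve_left hxz)).resolve_left ?_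
  exact_mod_cast (P.mpos i).ne'

/-- If `h` acts nontrivially, some weight is a positive integer on `h` or on `-h`. -/
lemma exists_wtSp_pos (hint : M.Integrable) (hlz : M.LevelZero) (S : C.Triple)
    (hS : M.ρ (X.E 0 (S.h : P.g)) ≠ 0) :
    ∃ (S' : C.Triple) (m : ℕ) (w : C.Wt), 0 < m ∧ w.1 S'.h = m ∧ M.wtSp w ≠ ⊥ := by
  obtain ⟨w, hw, hwh⟩ : ∃ w, M.wtSp w ≠ ⊥ ∧ w.1 S.h ≠ 0 := by
    by_contra! hcon
    refine hS (LinearMap.ker_eq_top.mp (eq_top_iff.mpr ?_))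
    have hwt : (⨆ w : C.Wt, M.wtSp w) = ⊤ := hint.1
    rw [← hwt]
    refine iSup_le fun w v hv => ?_
    by_cases hv0 : v = 0
    · simp [hv0]
    · have h1 := hcon w (fun h => hv0 (by simpa [h] using hv))
      simpa [h1] using (M.mem_wtSp.mp hv).1 S.h
  obtain ⟨v, hv, hv0⟩ := (Submodule.ne_bot_iff _).mp hw
  have hsl := hlz.isSl2Ops S PreT.inΓ_zero
  rw [neg_zero] at hsl
  obtain ⟨k, hk⟩ := hsl.weight_int (hint.locNil_e S PreT.inΓ_zero)
    (hint.locNil_f S PreT.inΓ_zero) hv0 ((M.mem_wtSp.mp hv).1 S.h)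
  have hk0 : k ≠ 0 := by rintro rfl; simp [hk] at hwh
  obtain ⟨m, rfl | rfl⟩ := k.eq_nat_or_neg
  · exact ⟨S, m, w, by omega, by simpa using hk, hw⟩
  · exact ⟨S.swap, m, w, by omega, by simp [Cartan.Triple.swap, hk], hw⟩

/-- A locally nilpotent homogeneous element of `𝒵(m)` kills some weight vector with the same
`𝔥_{0̄}`-weight as a given one. -/
lemma exists_K_apply_eq_zero {b : Fin P.n → ℤ} (hb : P.inΓ b) {i : Fin P.n}
    (hnil : LocNil (M.ρ (X.K b i))) {w : C.Wt} (hw : M.wtSp w ≠ ⊥) :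
    ∃ (w' : C.Wt) (v : M.V), w'.1 = w.1 ∧ v ∈ M.wtSp w' ∧ v ≠ 0 ∧ M.ρ (X.K b i) v = 0 := by
  obtain ⟨v, hv, hv0⟩ := (Submodule.ne_bot_iff _).mp hw
  obtain ⟨N, hN, hN'⟩ := IsSl2Ops.exists_last hnil hv0
  refine ⟨_, _, ?_, M.pow_apply_mem_wtSp
    (fun w v => M.K_apply_mem_wtSp hb i (w := w) (v := v)) N hv, hN, by rwa [pow_succ'] at hN'⟩
  simp [Cartan.rootFn]

variable (P) in
/-- The element `(m₁, …, mₙ)` of `Γ`. -/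
def diag : Fin P.n → ℤ := fun i => P.m i

lemma inΓ_diag : P.inΓ (diag P) := fun _ => dvd_rfl

lemma diag_ne_zero (i : Fin P.n) : diag P i ≠ 0 := by
  simpa [diag] using (P.mpos i).ne'

/-- The product `t^{2s}K_{i'} · t^{-s}K_i`, `s = (m₁, …, mₙ)`, is locally nilpotent. -/
lemma locNil_K_mul_K (hirr : M.Irr) (hint : M.Integrable) (hlz : M.LevelZero) (hfin : M.FinWt)
    (S : C.Triple) {m : ℕ} (hm : 0 < m) {w : C.Wt} (hw : w.1 S.h = m) (hwV : M.wtSp w ≠ ⊥)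
    (i i' : Fin P.n) :
    LocNil (M.ρ (X.K (diag P + diag P) i') * M.ρ (X.K (-diag P) i)) := by
  have hs := inΓ_diag (P := P)
  have := hfin w
  have hmaps : ∀ v ∈ M.wtSp w,
      (M.ρ (X.K (diag P) i') * M.ρ (X.K (-diag P) i)) v ∈ M.wtSp w := by
    intro v hv
    have h1 := M.K_apply_mem_wtSp hs i' (M.K_apply_mem_wtSp hs.neg i hv)
    rwa [add_assoc, Cartan.rootFn_add, neg_add_cancel, add_zero, Cartan.rootFn_zero_zero,
      add_zero] at h1
  have : Nontrivial ↥(M.wtSp w) := Submodule.nontrivial_iff_ne_bot.mpr hwV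
  obtain ⟨c, hc⟩ := Module.End.exists_eigenvalue
    ((M.ρ (X.K (diag P) i') * M.ρ (X.K (-diag P) i)).restrict hmaps)
  obtain ⟨v, hv⟩ := hc.exists_hasEigenvector
  have hv0 : (v : M.V) ≠ 0 := fun h => hv.2 (Subtype.ext h)
  have hvc : (M.ρ (X.K (diag P) i') * M.ρ (X.K (-diag P) i)) (v : M.V) = c • (v : M.V) :=
    congrArg Subtype.val hv.apply_eq_smul
  set u : Module.End ℂ M.V :=
    M.ρ (X.K (diag P) i') * M.ρ (X.K (-diag P) i) - algebraMap ℂ (Module.End ℂ M.V) c with hu_def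
  have hu : u ∈ M.zAlg := sub_mem (mul_mem (K_mem_zAlg _ _) (K_mem_zAlg _ _))
    (Subalgebra.algebraMap_mem _ c)
  have huv : u v = 0 := by
    rw [hu_def, LinearMap.sub_apply, hvc, Module.algebraMap_end_apply, sub_self]
  have key := locNil_lie_Dop hirr hint hlz hfin S hm hw hu (hirr.locNil hu hv0 huv) v.2 hv0 huv hs i
  have hy : M.ρ (X.Dop (diag P) i) * M.ρ (X.K (-diag P) i) =
      M.ρ (X.K (-diag P) i) * M.ρ (X.Dop (diag P) i) := by
    rw [← sub_eq_zero, ← M.ρ_lie, X.br_DK _ _ hs hs.neg]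
    simp [hlz _]
  have hx : M.ρ (X.Dop (diag P) i) * M.ρ (X.K (diag P) i') =
      M.ρ (X.K (diag P) i') * M.ρ (X.Dop (diag P) i) +
        (diag P i : ℂ) • M.ρ (X.K (diag P + diag P) i') := by
    rw [← sub_eq_iff_eq_add', ← M.ρ_lie, X.br_DK _ _ hs hs]
    have h2 : ∑ p, (diag P p : ℂ) • X.K (diag P + diag P) p = 0 := by
      have h3 := X.K_dA _ (hs.add hs)
      simp only [Pi.add_apply, Int.cast_add, add_smul, Finset.sum_add_distrib] at h3
      rw [← two_smul ℂ] at h3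
      exact (smul_eq_zero.mp h3).resolve_left two_ne_zero
    rw [h2, smul_zero, add_zero, map_smul]
  have hlie : M.ρ (X.Dop (diag P) i) * u - u * M.ρ (X.Dop (diag P) i) =
      (diag P i : ℂ) • (M.ρ (X.K (diag P + diag P) i') * M.ρ (X.K (-diag P) i)) := by
    rw [hu_def, mul_sub, sub_mul, Algebra.commutes c, ← mul_assoc, hx, add_mul, smul_mul_assoc,
      mul_assoc, hy, mul_assoc]
    abel
  rw [hlie] at key
  intro x
  obtain ⟨N, hN⟩ := key x
  refine ⟨N, ?_⟩
  rw [smul_pow, LinearMap.smul_apply] at hN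
  exact (smul_eq_zero.mp hN).resolve_left
    (pow_ne_zero _ (Int.cast_ne_zero.mpr (diag_ne_zero i)))

/-- In some degree with nonzero coordinates all of `𝒵(m)` acts locally nilpotently. -/
lemma exists_degree_locNil (hirr : M.Irr) (hint : M.Integrable) (hlz : M.LevelZero)
    (hfin : M.FinWt) (S : C.Triple) {m : ℕ} (hm : 0 < m) {w : C.Wt} (hw : w.1 S.h = m)
    (hwV : M.wtSp w ≠ ⊥) :
    ∃ b, P.inΓ b ∧ (∀ i, b i ≠ 0) ∧ ∀ i, LocNil (M.ρ (X.K b i)) := by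
  have hs := inΓ_diag (P := P)
  by_cases h : ∀ i, LocNil (M.ρ (X.K (-diag P) i))
  · exact ⟨_, hs.neg, fun i => neg_ne_zero.mpr (diag_ne_zero i), h⟩
  push Not at h
  obtain ⟨i, hi⟩ := h
  refine ⟨_, hs.add hs, fun i => ?_, fun i' => ?_⟩
  · have := diag_ne_zero i
    simp only [Pi.add_apply]
    omega
  · have hinj : ∀ v, M.ρ (X.K (-diag P) i) v = 0 → v = 0 := fun v hv => by
      by_contra hv0
      exact hi (hirr.locNil (K_mem_zAlg _ _) hv0 hv)
    have hinjp : ∀ N v, (M.ρ (X.K (-diag P) i) ^ N) v = 0 → v = 0 := by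
      intro N
      induction N with
      | zero => intro v hv; simpa using hv
      | succ N ih => intro v hv; rw [pow_succ] at hv; exact hinj v (ih _ hv)
    intro x
    obtain ⟨N, hN⟩ := locNil_K_mul_K hirr hint hlz hfin S hm hw hwV i i' x
    refine ⟨N, hinjp N _ ?_⟩
    rwa [(zAlg_commute (K_mem_zAlg _ _) (K_mem_zAlg _ _)).mul_pow,
      ((zAlg_commute (K_mem_zAlg _ _) (K_mem_zAlg _ _)).pow_pow N N).eq] at hN

/-- Every homogeneous element of `𝒵(m)` acts locally nilpotently. -/
lemma locNil_K (hirr : M.Irr) (hint : M.Integrable) (hlz : M.LevelZero)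
    (hfin : M.FinWt) (S : C.Triple) {m : ℕ} (hm : 0 < m) {w : C.Wt} (hw : w.1 S.h = m)
    (hwV : M.wtSp w ≠ ⊥) (a : Fin P.n → ℤ) (i : Fin P.n) : LocNil (M.ρ (X.K a i)) := by
  have hzero : X.K a i = 0 → LocNil (M.ρ (X.K a i)) := fun h v => ⟨1, by simp [h]⟩
  by_cases ha : P.inΓ a
  swap
  · exact hzero (X.K_not a i ha)
  by_cases hj : ∃ j, j ≠ i
  · obtain ⟨j, hj⟩ := hj
    obtain ⟨b, hb, hb0, hbn⟩ := exists_degree_locNil hirr hint hlz hfin S hm hw hwV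
    obtain ⟨w', v, hw', hv, hv0, hKv⟩ := exists_K_apply_eq_zero hb (hbn i) hwV
    have key := locNil_lie_Dop hirr hint hlz hfin S hm (hw' ▸ hw) (K_mem_zAlg b i) (hbn i) hv hv0
      hKv (ha.sub hb) j
    rw [← M.ρ_lie, X.br_DK _ _ (ha.sub hb) hb, if_neg hj, zero_smul, add_zero, sub_add_cancel,
      map_smul] at key
    intro x
    obtain ⟨N, hN⟩ := key x
    refine ⟨N, ?_⟩
    rw [smul_pow, LinearMap.smul_apply] at hN
    exact (smul_eq_zero.mp hN).resolve_left (pow_ne_zero _ (Int.cast_ne_zero.mpr (hb0 j)))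
  · push Not at hj
    by_cases hai : a i = 0
    · have : a = 0 := funext fun j => by rw [hj j, hai]; rfl
      subst this
      exact fun v => ⟨1, by simp [hlz i]⟩
    · have h1 := X.K_dA a ha
      rw [Finset.sum_eq_single i (fun j _ h => absurd (hj j) h) (by simp)] at h1
      exact hzero ((smul_eq_zero.mp h1).resolve_left (Int.cast_ne_zero.mpr hai))

end TRep

namespace TRep

variable {P : PreT} {C : Cartan P} {T : Torus P C} {X : Toroidal P C T} {M : TRep X}

variable (M) in
/-- The common kernel of finitely many elements of `𝒵(m)`. -/
def zKer (F : Finset ((Fin P.n → ℤ) × Fin P.n)) : Submodule ℂ M.V :=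
  ⨅ p ∈ F, LinearMap.ker (M.ρ (X.K p.1 p.2))

lemma mem_zKer {F : Finset ((Fin P.n → ℤ) × Fin P.n)} {v : M.V} :
    v ∈ M.zKer F ↔ ∀ p ∈ F, M.ρ (X.K p.1 p.2) v = 0 := by
  simp [zKer, Submodule.mem_iInf]

lemma zKer_anti {F F' : Finset ((Fin P.n → ℤ) × Fin P.n)} (h : F ⊆ F') : M.zKer F' ≤ M.zKer F :=
  fun _ hv => mem_zKer.mpr fun p hp => mem_zKer.mp hv p (h hp)

lemma exists_wtSp_inf_zKer_ne_bot (hnil : ∀ r i, LocNil (M.ρ (X.K r i))) {w : C.Wt}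
    (hw : M.wtSp w ≠ ⊥) (F : Finset ((Fin P.n → ℤ) × Fin P.n)) :
    ∃ k, P.inΓ k ∧ M.wtSp (w + C.rootFn 0 k) ⊓ M.zKer F ≠ ⊥ := by
  classical
  induction F using Finset.induction_on with
  | empty => exact ⟨0, PreT.inΓ_zero, by simpa [zKer, Cartan.rootFn_zero_zero] using hw⟩
  | insert p F _ ih =>
    obtain ⟨k, hk, hne⟩ := ih
    obtain ⟨v, ⟨hv, hvF⟩, hv0⟩ := (Submodule.ne_bot_iff _).mp hne
    by_cases hp : P.inΓ p.1
    · obtain ⟨N, hN, hN'⟩ := IsSl2Ops.exists_last (hnil p.1 p.2) hv0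
      have hmem := M.pow_apply_mem_wtSp
        (fun w v => M.K_apply_mem_wtSp hp p.2 (w := w) (v := v)) N hv
      rw [add_assoc, Cartan.rootFn_add, smul_zero, add_zero] at hmem
      refine ⟨_, hk.add (hp.nsmul N), (Submodule.ne_bot_iff _).mpr
        ⟨_, ⟨hmem, mem_zKer.mpr fun q hq => ?_⟩, hN⟩⟩
      rcases Finset.mem_insert.mp hq with rfl | hq
      · rwa [pow_succ'] at hN'
      · rw [← Module.End.mul_apply,
          ((zAlg_commute (K_mem_zAlg _ _) (K_mem_zAlg _ _)).pow_right N).eq, Module.End.mul_apply, mem_zKer.mp hvF q hq, map_zero]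
    · refine ⟨k, hk, (Submodule.ne_bot_iff _).mpr ⟨v, ⟨hv, mem_zKer.mpr fun q hq => ?_⟩, hv0⟩⟩
      rcases Finset.mem_insert.mp hq with rfl | hq
      · simp [X.K_not _ _ hp]
      · exact mem_zKer.mp hvF q hq

variable (P) in
/-- The element `(m₁c₁, …, mₙcₙ)` of `Γ`. -/
def latticePt (c : Fin P.n → ℕ) : Fin P.n → ℤ := fun i => P.m i * c i

/-- The points `latticePt c`, `0 ≤ cᵢ < m`, represent `Γ / mΓ`. -/
lemma exists_latticePt {m : ℕ} (hm : 0 < m) {k : Fin P.n → ℤ} (hk : P.inΓ k) :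
    ∃ c ∈ Fintype.piFinset fun _ : Fin P.n => Finset.range m, ∃ s, P.inΓ s ∧
      k + m • s = latticePt P c := by
  choose q hq using hk
  have hm' : (m : ℤ) ≠ 0 := by exact_mod_cast hm.ne'
  refine ⟨fun i => (q i % m).toNat, ?_, fun i => P.m i * -(q i / m), fun i => dvd_mul_right _ _, ?_⟩
  · rw [Fintype.mem_piFinset]
    intro i
    rw [Finset.mem_range]
    have := Int.emod_nonneg (q i) hm'
    have := Int.emod_lt_of_pos (q i) (by omega : (0 : ℤ) < m)
    omega
  · ext i
    rw [Pi.add_apply, Pi.smul_apply, nsmul_eq_mul, hq i, latticePt,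
      Int.toNat_of_nonneg (Int.emod_nonneg (q i) hm')]
    linear_combination (P.m i : ℤ) * -(Int.emod_add_mul_ediv (q i) m)

/-- If `𝒵(m)` acts locally nilpotently, some nonzero vector is killed by `𝒵(m)`. -/
lemma exists_forall_K_apply_eq_zero (hint : M.Integrable) (hlz : M.LevelZero) (hfin : M.FinWt)
    (S : C.Triple) {m : ℕ} (hm : 0 < m) {w : C.Wt} (hw : w.1 S.h = m) (hwV : M.wtSp w ≠ ⊥)
    (hnil : ∀ r i, LocNil (M.ρ (X.K r i))) : ∃ v : M.V, v ≠ 0 ∧ ∀ r i, M.ρ (X.K r i) v = 0 := by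
  classical
  let W (F : Finset ((Fin P.n → ℤ) × Fin P.n)) (c : Fin P.n → ℕ) : Submodule ℂ M.V :=
    M.wtSp (w + C.rootFn 0 (latticePt P c)) ⊓ M.zKer F
  have hWfin : ∀ F c, FiniteDimensional ℂ ↥(W F c) := fun F c =>
    have := hfin (w + C.rootFn 0 (latticePt P c))
    Submodule.finiteDimensional_inf_left _ _
  let D := Fintype.piFinset fun _ : Fin P.n => Finset.range m
  let φ (F : Finset ((Fin P.n → ℤ) × Fin P.n)) : ℕ := ∑ c ∈ D, Module.finrank ℂ ↥(W F c)
  let F := Function.argmin φ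
  obtain ⟨k, hk, hne⟩ := exists_wtSp_inf_zKer_ne_bot hnil hwV F
  obtain ⟨v, ⟨hv, hvF⟩, hv0⟩ := (Submodule.ne_bot_iff _).mp hne
  obtain ⟨c, hc, s, hs, hks⟩ := exists_latticePt hm hk
  obtain ⟨t, ht, htw⟩ := exists_translation hlz hint S
    (w := w + C.rootFn 0 k) (m := m) (by simpa [Cartan.rootFn] using hw) hs
  have htv : t v ∈ W F c := by
    refine ⟨?_, mem_zKer.mpr fun p hp => ?_⟩
    · have h1 := (htw v hv).1
      rwa [add_assoc, Cartan.rootFn_add, add_zero, hks] at h1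
    · rw [← Module.End.mul_apply, ← (ht _ (K_mem_zAlg _ _)).eq, Module.End.mul_apply,
        mem_zKer.mp hvF p hp, map_zero]
  refine ⟨t v, fun h => hv0 ((htw v hv).2 h), fun r i => ?_⟩
  have hle : ∀ c, W (insert (r, i) F) c ≤ W F c := fun c =>
    inf_le_inf_left _ (zKer_anti (Finset.subset_insert _ _))
  have hrank : ∀ c ∈ D, Module.finrank ℂ ↥(W (insert (r, i) F) c) ≤ Module.finrank ℂ ↥(W F c) :=
    fun c _ => Submodule.finrank_mono (hle c)
  have heq := (Finset.sum_eq_sum_iff_of_le hrank).mp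
    (le_antisymm (Finset.sum_le_sum hrank) (Function.argmin_le φ _)) c hc
  rw [← Submodule.eq_of_le_of_finrank_eq (hle c) heq] at htv
  exact mem_zKer.mp htv.2 (r, i) (Finset.mem_insert_self _ _)

/-- In an irreducible module, `𝒵(m)` acts by zero as soon as it kills a nonzero vector. -/
lemma Irr.ztrivial_of_exists (hirr : M.Irr)
    (h : ∃ v : M.V, v ≠ 0 ∧ ∀ r i, M.ρ (X.K r i) v = 0) : M.Ztrivial := by
  let U : Submodule ℂ M.V := ⨅ (r) (i), LinearMap.ker (M.ρ (X.K r i))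
  have hU : ∀ {v}, v ∈ U ↔ ∀ r i, M.ρ (X.K r i) v = 0 := by simp [U, Submodule.mem_iInf]
  have key := hirr.eq_bot_or_eq_top U ?_ ?_ ?_
  · rcases key with h0 | h0
    · obtain ⟨v, hv0, hv⟩ := h
      exact absurd ((Submodule.mem_bot ℂ).mp (h0 ▸ hU.mpr hv)) hv0
    · intro r _ i
      ext v
      exact hU.mp (h0 ▸ Submodule.mem_top : v ∈ U) r i
  · intro k x hx v hv
    refine hU.mpr fun r i => ?_
    rw [← Module.End.mul_apply, ← (E_commute_zAlg hx (K_mem_zAlg r i)).eq, Module.End.mul_apply,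
      hU.mp hv, map_zero]
  · intro s j _ v hv
    exact hU.mpr fun r i => by rw [hU.mp hv s j, map_zero]
  · intro s j hs v hv
    refine hU.mpr fun r i => ?_
    by_cases hr : P.inΓ r
    · have h1 := M.ρ_comm_apply (X.Dop s j) (X.K r i) v
      rw [X.br_DK s r hs hr] at h1
      simp only [map_add, map_smul, map_sum, LinearMap.add_apply, LinearMap.smul_apply,
        LinearMap.sum_apply, hU.mp hv, map_zero, smul_zero, Finset.sum_const_zero, add_zero] at h1
      exact h1.symm
    · simp [X.K_not r i hr]

end TRep

section Statements

variable {P : PreT} {C : Cartan P} {T : Torus P C} {X : Toroidal P C T}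

/-- Corollary 4.9: `𝒵(m)` acts trivially on every level zero irreducible
integrable `τ̃`-module with finite-dimensional weight spaces. -/
theorem statement7 (M : TRep X) (hirr : M.Irr) (hint : M.Integrable)
    (hlz : M.LevelZero) (hfin : M.FinWt) : M.Ztrivial := by
  obtain ⟨S⟩ := T.nonempty_triple
  by_cases hS : M.ρ (X.E 0 (S.h : P.g)) = 0
  · exact TRep.ztrivial_of_exists_ρ_E_eq_zero ⟨S.h, C.h0_le S.h.2, S.h_ne, hS⟩
  obtain ⟨S', m, w, hm, hw, hwV⟩ := TRep.exists_wtSp_pos hint hlz S hS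
  exact hirr.ztrivial_of_exists (TRep.exists_forall_K_apply_eq_zero hint hlz hfin S' hm hw hwV
    (TRep.locNil_K hirr hint hlz hfin S' hm hw hwV))

end Statements
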